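/- Under the setup of the TVLQR Lyapunov identity — S : [0, T] → ℝ^{n×n} differentiable, each S_t symmetric positive definite, satisfying −Ṡ_t = S_t A_t + A_tᵀ S_t − S_t B_t R_t^{−1} B_tᵀ S_t + Q_t with R_t invertible, K_t := R_t^{−1} B_tᵀ S_t, and x̃′_t = (A_t − B_t K_t) x̃_t — define for each t the scalar c_t := (1/2) · λ_max( S_t^{−1/2} (−Q_t − K_tᵀ R_t K_t) S_t^{−1/2} ), where λ_max denotes the largest eigenvalue of a symmetric matrix and S_t^{−1/2} is the inverse of the positive definite square root of S_t. Then: (i) d/dt [ x̃_tᵀ S_t x̃_t ] ≤ 2 c_t · x̃_tᵀ S_t x̃_t for all t ∈ [0, T]; and (ii) if additionally Q_t is symmetric positive semidefinite and R_t is symmetric positive definite, then c_t ≤ 0. -/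

import Mathlib

open Matrix

/-- The largest eigenvalue of a symmetric matrix `N`, characterized as the least `l`
such that `l•I − N` is positive semidefinite. -/
noncomputable def symMaxEig {n : ℕ} (N : Matrix (Fin n) (Fin n) ℝ) : ℝ :=
  sInf {l : ℝ | (l • (1 : Matrix (Fin n) (Fin n) ℝ) - N).PosSemidef}

theorem exists_posSemidef_smul_one_sub {n : ℕ} {N : Matrix (Fin n) (Fin n) ℝ} (hN : N.IsSymm) :
    ∃ l : ℝ, (l • (1 : Matrix (Fin n) (Fin n) ℝ) - N).PosSemidef := by
  refine ⟨∑ i, ∑ j, |N i j|, .of_dotProduct_mulVec_nonneg ?_ fun y => ?_⟩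
  · rw [Matrix.IsHermitian, conjTranspose_eq_transpose_of_trivial, transpose_sub, transpose_smul,
      transpose_one, hN.eq]
  · have hsq (i : Fin n) : y i ^ 2 ≤ y ⬝ᵥ y := by
      rw [sq]
      exact Finset.single_le_sum (f := fun i => y i * y i) (fun i _ => mul_self_nonneg _)
        (Finset.mem_univ i)
    have hentry (i j : Fin n) : y i * (N i j * y j) ≤ |N i j| * (y ⬝ᵥ y) := by
      have hprod : |y i * y j| ≤ y ⬝ᵥ y := by
        have := hsq i
        have := hsq j
        rw [abs_le]
        constructor <;> nlinarith [sq_nonneg (y i + y j), sq_nonneg (y i - y j)]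
      calc y i * (N i j * y j) = N i j * (y i * y j) := by ring
        _ ≤ |N i j * (y i * y j)| := le_abs_self _
        _ = |N i j| * |y i * y j| := abs_mul _ _
        _ ≤ _ := by gcongr
    rw [star_trivial, sub_mulVec, smul_mulVec, one_mulVec, dotProduct_sub, dotProduct_smul,
      smul_eq_mul, sub_nonneg]
    calc y ⬝ᵥ N *ᵥ y = ∑ i, ∑ j, y i * (N i j * y j) := by
          simp only [dotProduct, mulVec, Finset.mul_sum]
      _ ≤ ∑ i, ∑ j, |N i j| * (y ⬝ᵥ y) :=
          Finset.sum_le_sum fun i _ => Finset.sum_le_sum fun j _ => hentry i j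
      _ = (∑ i, ∑ j, |N i j|) * (y ⬝ᵥ y) := by simp only [Finset.sum_mul]

theorem dotProduct_mulVec_le_symMaxEig {n : ℕ} {N : Matrix (Fin n) (Fin n) ℝ} (hN : N.IsSymm)
    (y : Fin n → ℝ) : y ⬝ᵥ N *ᵥ y ≤ symMaxEig N * (y ⬝ᵥ y) := by
  rcases eq_or_ne y 0 with rfl | hy
  · simp
  have hpos : 0 < y ⬝ᵥ y := by simpa using dotProduct_star_self_pos_iff.2 hy
  rw [← div_le_iff₀ hpos]
  refine le_csInf (exists_posSemidef_smul_one_sub hN) fun l hl => ?_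
  rw [div_le_iff₀ hpos]
  have h := (show (l • (1 : Matrix (Fin n) (Fin n) ℝ) - N).PosSemidef from
    hl).dotProduct_mulVec_nonneg y
  rwa [star_trivial, sub_mulVec, smul_mulVec, one_mulVec, dotProduct_sub, dotProduct_smul,
    smul_eq_mul, sub_nonneg] at h

theorem symMaxEig_nonpos {n : ℕ} {N : Matrix (Fin n) (Fin n) ℝ} (hN : (-N).PosSemidef) :
    symMaxEig N ≤ 0 :=
  Real.sInf_nonpos' ⟨0, by simpa using hN, le_rfl⟩

/-- Rayleigh quotient bound for the form of `M` relative to the form of `H * H`. -/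
theorem dotProduct_mulVec_le_symMaxEig_conj {n : ℕ} {M H : Matrix (Fin n) (Fin n) ℝ}
    (hM : M.IsSymm) (hH : H.IsSymm) (hdet : IsUnit H.det) (x : Fin n → ℝ) :
    x ⬝ᵥ M *ᵥ x ≤ symMaxEig (H⁻¹ * M * H⁻¹) * (x ⬝ᵥ (H * H) *ᵥ x) := by
  have hN : (H⁻¹ * M * H⁻¹).IsSymm := by
    rw [Matrix.IsSymm, transpose_mul, transpose_mul, transpose_nonsing_inv, hH.eq, hM.eq,
      Matrix.mul_assoc]
  have hform (P : Matrix (Fin n) (Fin n) ℝ) :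
      (H *ᵥ x) ⬝ᵥ P *ᵥ (H *ᵥ x) = x ⬝ᵥ (H * P * H) *ᵥ x := by
    rw [← mulVec_mulVec, ← mulVec_mulVec, dotProduct_mulVec x H, ← mulVec_transpose, hH.eq]
  have hconj : H * (H⁻¹ * M * H⁻¹) * H = M := by
    rw [Matrix.mul_assoc, nonsing_inv_mul_cancel_right _ _ hdet,
      mul_nonsing_inv_cancel_left _ _ hdet]
  have h := dotProduct_mulVec_le_symMaxEig hN (H *ᵥ x)
  have hone := hform 1
  rw [one_mulVec, Matrix.mul_one] at hone
  rwa [hform, hconj, hone] at h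

theorem HasDerivWithinAt.dotProduct_mulVec_self {n : ℕ} {S : ℝ → Matrix (Fin n) (Fin n) ℝ}
    {S' : Matrix (Fin n) (Fin n) ℝ} {x : ℝ → Fin n → ℝ} {x' : Fin n → ℝ} {s : Set ℝ} {t : ℝ}
    (hS : ∀ i j, HasDerivWithinAt (fun r => S r i j) (S' i j) s t)
    (hx : HasDerivWithinAt x x' s t) :
    HasDerivWithinAt (fun r => x r ⬝ᵥ S r *ᵥ x r)
      (x' ⬝ᵥ S t *ᵥ x t + (x t ⬝ᵥ S' *ᵥ x t + x t ⬝ᵥ S t *ᵥ x')) s t := by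
  rw [hasDerivWithinAt_pi] at hx
  simp only [dotProduct, mulVec, ← Finset.sum_add_distrib, ← mul_add]
  exact HasDerivWithinAt.fun_sum fun i _ => (hx i).mul
    (HasDerivWithinAt.fun_sum fun j _ => (hS i j).mul (hx j))

/-- The derivative of a curve of symmetric matrices is symmetric. -/
theorem isSymm_of_hasDerivWithinAt {n : ℕ} {S : ℝ → Matrix (Fin n) (Fin n) ℝ}
    {S' : Matrix (Fin n) (Fin n) ℝ} {s : Set ℝ} {t : ℝ} (hs : UniqueDiffWithinAt ℝ s t)
    (ht : t ∈ s) (hsymm : ∀ r ∈ s, (S r).IsSymm)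
    (hS : ∀ i j, HasDerivWithinAt (fun r => S r i j) (S' i j) s t) : S'.IsSymm := by
  ext i j
  exact hs.eq_deriv _ (hS j i)
    ((hS i j).congr (fun r hr => (hsymm r hr).apply i j) ((hsymm t ht).apply i j))

section Riccati

variable {n p : ℕ} {A S S' Q : Matrix (Fin n) (Fin n) ℝ} {B : Matrix (Fin n) (Fin p) ℝ}
  {R : Matrix (Fin p) (Fin p) ℝ}

theorem transpose_gain_mul_mul_gain (hR : IsUnit R.det) (hS : S.IsSymm) :
    (R⁻¹ * Bᵀ * S)ᵀ * R * (R⁻¹ * Bᵀ * S) = (S * B * R⁻¹ * Bᵀ * S)ᵀ := by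
  simp only [transpose_mul, transpose_transpose, hS.eq, Matrix.mul_assoc,
    mul_nonsing_inv_cancel_left _ _ hR]

theorem isSymm_of_riccati (hR : IsUnit R.det) (hS : S.IsSymm) (hS' : S'.IsSymm)
    (hric : -S' = S * A + Aᵀ * S - S * B * R⁻¹ * Bᵀ * S + Q) :
    (-Q - (R⁻¹ * Bᵀ * S)ᵀ * R * (R⁻¹ * Bᵀ * S)).IsSymm := by
  have hrict := congrArg transpose hric
  rw [transpose_gain_mul_mul_gain hR hS, Matrix.IsSymm]
  set G := S * B * R⁻¹ * Bᵀ * S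
  simp only [transpose_neg, transpose_add, transpose_sub, transpose_mul, transpose_transpose,
    hS.eq, hS'.eq] at hrict ⊢
  have hQ : Q = -S' - S * A - Aᵀ * S + G := by rw [hric]; abel
  have hQt : Qᵀ = -S' - S * A - Aᵀ * S + Gᵀ := by rw [hrict]; abel
  rw [hQt, hQ]
  abel

theorem lyapunov_identity_of_riccati (hR : IsUnit R.det) (hS : S.IsSymm)
    (hric : -S' = S * A + Aᵀ * S - S * B * R⁻¹ * Bᵀ * S + Q) :
    (A - B * (R⁻¹ * Bᵀ * S))ᵀ * S + (S' + S * (A - B * (R⁻¹ * Bᵀ * S))) =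
      -Q - (R⁻¹ * Bᵀ * S)ᵀ * R * (R⁻¹ * Bᵀ * S) := by
  rw [transpose_gain_mul_mul_gain hR hS, ← neg_neg S', hric]
  simp only [transpose_sub, transpose_mul, transpose_transpose, hS.eq, Matrix.sub_mul,
    Matrix.mul_sub, Matrix.mul_assoc]
  abel

end Riccati

/-- Contraction rate induced by the TVLQR Riccati solution: with
`c_t = (1/2)λ_max(S_t^{−1/2}(−Q_t − K_tᵀR_tK_t)S_t^{−1/2})`, the closed-loop energy
satisfies `d/dt (x̃ᵀS_tx̃) ≤ 2c_t x̃ᵀS_tx̃`, and `c_t ≤ 0` whenever `Q_t ⪰ 0` and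
`R_t ≻ 0`. -/
theorem tvlqr_contraction_rate {n p : ℕ} (T : ℝ) (hT : 0 < T)
    (A : ℝ → Matrix (Fin n) (Fin n) ℝ) (B : ℝ → Matrix (Fin n) (Fin p) ℝ)
    (Q : ℝ → Matrix (Fin n) (Fin n) ℝ) (R : ℝ → Matrix (Fin p) (Fin p) ℝ)
    (hRinv : ∀ t ∈ Set.Icc (0 : ℝ) T, IsUnit (R t).det)
    (S S' : ℝ → Matrix (Fin n) (Fin n) ℝ)
    (hSsymm : ∀ t ∈ Set.Icc (0 : ℝ) T, (S t).IsSymm)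
    (hSpos : ∀ t ∈ Set.Icc (0 : ℝ) T, (S t).PosDef)
    (hS : ∀ t ∈ Set.Icc (0 : ℝ) T, ∀ i j,
      HasDerivWithinAt (fun s => S s i j) (S' t i j) (Set.Icc 0 T) t)
    (hRiccati : ∀ t ∈ Set.Icc (0 : ℝ) T,
      -S' t = S t * A t + (A t)ᵀ * S t - S t * B t * (R t)⁻¹ * (B t)ᵀ * S t + Q t)
    (Shalf : ℝ → Matrix (Fin n) (Fin n) ℝ)
    (hShalf : ∀ t ∈ Set.Icc (0 : ℝ) T,
      Shalf t * Shalf t = S t ∧ (Shalf t).PosDef ∧ (Shalf t).IsSymm)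
    (xt : ℝ → (Fin n → ℝ))
    (hxt : ∀ t ∈ Set.Icc (0 : ℝ) T,
      HasDerivWithinAt xt
        ((A t - B t * ((R t)⁻¹ * (B t)ᵀ * S t)) *ᵥ xt t) (Set.Icc 0 T) t) :
    let K : ℝ → Matrix (Fin p) (Fin n) ℝ := fun t => (R t)⁻¹ * (B t)ᵀ * S t
    let c : ℝ → ℝ := fun t =>
      (1 / 2) * symMaxEig ((Shalf t)⁻¹ * (-(Q t) - (K t)ᵀ * R t * K t) * (Shalf t)⁻¹)
    (∀ t ∈ Set.Icc (0 : ℝ) T,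
      derivWithin (fun s => xt s ⬝ᵥ (S s *ᵥ xt s)) (Set.Icc 0 T) t ≤
        2 * c t * (xt t ⬝ᵥ (S t *ᵥ xt t))) ∧
    ((∀ t ∈ Set.Icc (0 : ℝ) T, (Q t).IsSymm ∧ (Q t).PosSemidef) →
     (∀ t ∈ Set.Icc (0 : ℝ) T, (R t).IsSymm ∧ (R t).PosDef) →
     ∀ t ∈ Set.Icc (0 : ℝ) T, c t ≤ 0) := by
  intro K c
  refine ⟨fun t ht => ?_, fun hQ hR t ht => ?_⟩
  · have hud := uniqueDiffOn_Icc hT t ht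
    obtain ⟨hsq, hpd, hsy⟩ := hShalf t ht
    have hsymm := isSymm_of_riccati (hRinv t ht) (hSsymm t ht)
      (isSymm_of_hasDerivWithinAt hud ht hSsymm (hS t ht)) (hRiccati t ht)
    have hray := dotProduct_mulVec_le_symMaxEig_conj hsymm hsy hpd.det_pos.ne'.isUnit (xt t)
    rw [hsq] at hray
    rw [(HasDerivWithinAt.dotProduct_mulVec_self (hS t ht) (hxt t ht)).derivWithin hud]
    calc _ = xt t ⬝ᵥ (-(Q t) - (K t)ᵀ * R t * K t) *ᵥ xt t := by
          rw [← lyapunov_identity_of_riccati (hRinv t ht) (hSsymm t ht) (hRiccati t ht),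
            add_mulVec, add_mulVec, dotProduct_add, dotProduct_add, ← mulVec_mulVec,
            ← mulVec_mulVec, dotProduct_mulVec (xt t) (_)ᵀ, vecMul_transpose]
      _ ≤ _ := hray
      _ = _ := by simp only [c]; ring
  · obtain ⟨-, -, hsy⟩ := hShalf t ht
    have hcost : (Q t + (K t)ᵀ * R t * K t).PosSemidef := by
      simpa using (hQ t ht).2.add ((hR t ht).2.posSemidef.conjTranspose_mul_mul_same (K t))
    have hconj := hcost.conjTranspose_mul_mul_same (Shalf t)⁻¹
    rw [conjTranspose_eq_transpose_of_trivial, transpose_nonsing_inv, hsy.eq] at hconj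
    refine mul_nonpos_of_nonneg_of_nonpos (by norm_num) (symMaxEig_nonpos ?_)
    rwa [← Matrix.neg_mul, ← Matrix.mul_neg, neg_sub', neg_neg, sub_neg_eq_add]
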